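/- Let p be a prime and m a nonnegative integer. Then a_R^{cc}(p^m) equals the number of tuples (k, l, r, a₂₁, a₃₁, a₃₂) with k, l, r nonnegative integers, k + l + r = m, and a₂₁, a₃₁, a₃₂ integers, satisfying: 0 ≤ a₂₁ < p^k, 0 ≤ a₃₁ < p^k, 0 ≤ a₃₂ < p^l, l ≤ 2r, k ≤ l + r, p^{k+l−r} divides 2p^l·a₃₂ − p^r·a₂₁ whenever k + l − r > 0, and gcd(p^{k+l+r}, p^{l+r}, p^r·a₂₁, a₂₁·a₃₂ − p^l·a₃₁, p^{k+r}, p^k·a₃₂, p^{k+l}) = 1. -/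

import Mathlib

/-- `R = ℤ[t]/(t⁴)`. -/
abbrev Rt4 : Type := Polynomial ℤ ⧸ Ideal.span ({Polynomial.X ^ 4} : Set (Polynomial ℤ))

/-- `a_R^{cc}(k)`: the number of cocyclic (unital) subrings of `ℤ[t]/(t⁴)` of additive
index `k`, i.e. those whose additive quotient `R/S` is cyclic. -/
noncomputable def aRcc (k : ℕ) : ℕ :=
  Nat.card {S : Subring Rt4 //
    S.toAddSubgroup.index = k ∧ IsAddCyclic (Rt4 ⧸ S.toAddSubgroup)}

open Polynomial in
/-- The class of `X` in `ℤ[X]/(X⁴)`. -/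
noncomputable def Rt4.t : Rt4 := Ideal.Quotient.mk _ X

namespace Rt4

theorem t_pow_four : t ^ 4 = 0 := by
  rw [t, ← map_pow, Ideal.Quotient.eq_zero_iff_mem]
  exact Ideal.mem_span_singleton_self _

/-- The additive map `(n, v) ↦ n + v₀ t + v₁ t² + v₂ t³`. -/
noncomputable def ofCoords : ℤ × (Fin 3 → ℤ) →+ Rt4 where
  toFun c := c.1 + c.2 0 * t + c.2 1 * t ^ 2 + c.2 2 * t ^ 3
  map_zero' := by simp
  map_add' c d := by simp; ring

theorem ofCoords_apply (n : ℤ) (v : Fin 3 → ℤ) :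
    ofCoords (n, v) = n + v 0 * t + v 1 * t ^ 2 + v 2 * t ^ 3 := rfl

open Polynomial in
theorem ofCoords_eq_mk (n : ℤ) (v : Fin 3 → ℤ) :
    ofCoords (n, v) =
      Ideal.Quotient.mk _ (C n + C (v 0) * X + C (v 1) * X ^ 2 + C (v 2) * X ^ 3) := by
  rw [ofCoords_apply, t]
  simp

open Polynomial in
theorem ofCoords_bijective : Function.Bijective ofCoords := by
  constructor
  · rw [injective_iff_map_eq_zero]
    rintro ⟨n, v⟩ h
    rw [ofCoords_eq_mk, Ideal.Quotient.eq_zero_iff_mem, Ideal.mem_span_singleton,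
      X_pow_dvd_iff] at h
    have h0 := h 0 (by norm_num)
    have h1 := h 1 (by norm_num)
    have h2 := h 2 (by norm_num)
    have h3 := h 3 (by norm_num)
    simp [coeff_X, coeff_C, coeff_X_pow, -eq_intCast] at h0 h1 h2 h3
    ext i
    · simpa using h0
    · fin_cases i <;> simp [h1, h2, h3]
  · intro x
    obtain ⟨f, rfl⟩ := Ideal.Quotient.mk_surjective x
    refine ⟨(f.coeff 0, ![f.coeff 1, f.coeff 2, f.coeff 3]), ?_⟩
    rw [ofCoords_eq_mk, Ideal.Quotient.eq, Ideal.mem_span_singleton, X_pow_dvd_iff]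
    intro d hd
    interval_cases d <;> simp [coeff_X, coeff_C, coeff_X_pow, -eq_intCast]

/-- The multiplication of `t R`, in the basis `t, t², t³`. -/
def tailMul (u v : Fin 3 → ℤ) : Fin 3 → ℤ :=
  ![0, u 0 * v 0, u 0 * v 1 + u 1 * v 0]

theorem ofCoords_mul (a b : ℤ) (u v : Fin 3 → ℤ) :
    ofCoords (a, u) * ofCoords (b, v) = ofCoords (a * b, a • v + b • u + tailMul u v) := by
  simp only [ofCoords_apply, tailMul, Pi.add_apply, Pi.smul_apply, smul_eq_mul,
    Matrix.cons_val_zero, Matrix.cons_val_one, Matrix.cons_val]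
  push_cast
  linear_combination ((u 1 * v 1 + u 0 * v 2 + u 2 * v 0 : Rt4) +
    (u 1 * v 2 + u 2 * v 1) * t + u 2 * v 2 * t ^ 2) * t_pow_four

/-- The coordinates of an element of `R` along `t, t², t³`. -/
noncomputable def tail : Rt4 →+ (Fin 3 → ℤ) :=
  (AddMonoidHom.snd _ _).comp (AddEquiv.ofBijective ofCoords ofCoords_bijective).symm.toAddMonoidHom

theorem tail_ofCoords (n : ℤ) (v : Fin 3 → ℤ) : tail (ofCoords (n, v)) = v := by
  have := (AddEquiv.ofBijective ofCoords ofCoords_bijective).symm_apply_apply (n, v)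
  exact congrArg Prod.snd this

theorem tail_surjective : Function.Surjective tail := fun v => ⟨_, tail_ofCoords 0 v⟩

theorem exists_eq_ofCoords (x : Rt4) : ∃ n, x = ofCoords (n, tail x) := by
  obtain ⟨⟨n, v⟩, rfl⟩ := ofCoords_bijective.2 x
  exact ⟨n, by rw [tail_ofCoords]⟩

theorem ofCoords_mem_iff (S : Subring Rt4) (a b : ℤ) (v : Fin 3 → ℤ) :
    ofCoords (a, v) ∈ S ↔ ofCoords (b, v) ∈ S := by
  have h : ofCoords (a, v) = ofCoords (b, v) + ((a - b : ℤ) : Rt4) := by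
    simp only [ofCoords_apply]; push_cast; ring
  rw [h, add_mem_cancel_right (intCast_mem S _)]

/-- Unital subrings of `R` correspond to the multiplicatively closed sublattices of `t R`. -/
noncomputable def subringEquiv : Subring Rt4 ≃
    {L : AddSubgroup (Fin 3 → ℤ) // ∀ u ∈ L, ∀ v ∈ L, tailMul u v ∈ L} where
  toFun S := ⟨S.toAddSubgroup.map tail, by
    rintro _ ⟨x, hx, rfl⟩ _ ⟨y, hy, rfl⟩
    obtain ⟨a, ha⟩ := exists_eq_ofCoords x
    obtain ⟨b, hb⟩ := exists_eq_ofCoords y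
    rw [ha] at hx
    rw [hb] at hy
    have hx' := (ofCoords_mem_iff S a 0 _).1 hx
    have hy' := (ofCoords_mem_iff S b 0 _).1 hy
    refine ⟨_, S.mul_mem hx' hy', ?_⟩
    rw [ofCoords_mul, tail_ofCoords]
    simp⟩
  invFun L :=
    { L.1.comap tail with
      one_mem' := by
        have : (1 : Rt4) = ofCoords (1, 0) := by simp [ofCoords_apply]
        change tail 1 ∈ L.1
        rw [this, tail_ofCoords]
        exact L.1.zero_mem
      mul_mem' := by
        intro x y hx hy
        change tail (x * y) ∈ L.1
        obtain ⟨a, ha⟩ := exists_eq_ofCoords x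
        obtain ⟨b, hb⟩ := exists_eq_ofCoords y
        rw [ha, hb, ofCoords_mul, tail_ofCoords]
        exact add_mem (add_mem (zsmul_mem hy _) (zsmul_mem hx _)) (L.2 _ hx _ hy) }
  left_inv S := by
    ext x
    change tail x ∈ S.toAddSubgroup.map tail ↔ x ∈ S
    constructor
    · rintro ⟨y, hy, hyx⟩
      obtain ⟨a, ha⟩ := exists_eq_ofCoords x
      obtain ⟨b, hb⟩ := exists_eq_ofCoords y
      rw [hyx] at hb
      rw [ha, ofCoords_mem_iff S a b, ← hb]
      exact hy
    · exact fun hx => ⟨x, hx, rfl⟩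
  right_inv L := Subtype.ext (AddSubgroup.map_comap_eq_self_of_surjective tail_surjective _)

theorem toAddSubgroup_eq_comap (S : Subring Rt4) :
    S.toAddSubgroup = (subringEquiv S).1.comap tail := by
  conv_lhs => rw [← subringEquiv.symm_apply_apply S]
  rfl

end Rt4

theorem isAddCyclic_quotient_iff {G : Type*} [AddCommGroup G] (L : AddSubgroup G) :
    IsAddCyclic (G ⧸ L) ↔ ∃ g, ∀ x, ∃ n : ℤ, x - n • g ∈ L := by
  have key : ∀ (g x : G) (n : ℤ), n • (g : G ⧸ L) = x ↔ x - n • g ∈ L := by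
    intro g x n
    rw [← QuotientAddGroup.mk_zsmul, eq_comm, QuotientAddGroup.eq_iff_sub_mem]
  constructor
  · rintro ⟨g, hg⟩
    obtain ⟨g, rfl⟩ := QuotientAddGroup.mk_surjective g
    refine ⟨g, fun x => ?_⟩
    obtain ⟨n, hn⟩ := hg x
    exact ⟨n, (key g x n).1 hn⟩
  · rintro ⟨g, hg⟩
    refine ⟨g, fun x => ?_⟩
    obtain ⟨x, rfl⟩ := QuotientAddGroup.mk_surjective x
    obtain ⟨n, hn⟩ := hg x
    exact ⟨n, (key g x n).2 hn⟩

theorem isAddCyclic_quotient_comap_iff {G H : Type*} [AddCommGroup G] [AddCommGroup H]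
    (f : G →+ H) (hf : Function.Surjective f) (L : AddSubgroup H) :
    IsAddCyclic (G ⧸ L.comap f) ↔ IsAddCyclic (H ⧸ L) := by
  simp only [isAddCyclic_quotient_iff, hf.exists, hf.forall, AddSubgroup.mem_comap, map_sub,
    map_zsmul]

theorem aRcc_eq_card_lattices (n : ℕ) :
    aRcc n = Nat.card {L : AddSubgroup (Fin 3 → ℤ) //
      (∀ u ∈ L, ∀ v ∈ L, Rt4.tailMul u v ∈ L) ∧ L.index = n ∧
        IsAddCyclic ((Fin 3 → ℤ) ⧸ L)} := by
  refine Nat.card_congr ((Rt4.subringEquiv.subtypeEquiv fun S => ?_).trans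
    (Equiv.subtypeSubtypeEquivSubtypeInter _
      fun L : AddSubgroup (Fin 3 → ℤ) => L.index = n ∧ IsAddCyclic ((Fin 3 → ℤ) ⧸ L)))
  rw [← isAddCyclic_quotient_comap_iff _ Rt4.tail_surjective,
    ← AddSubgroup.index_comap_of_surjective _ Rt4.tail_surjective,
    isAddCyclic_quotient_iff, isAddCyclic_quotient_iff, Rt4.toAddSubgroup_eq_comap]

theorem AddSubgroup.index_range_toLin' {n : Type*} [Fintype n] [DecidableEq n]
    (M : Matrix n n ℤ) (hM : M.det ≠ 0) :
    (LinearMap.range (Matrix.toLin' M)).toAddSubgroup.index = M.det.natAbs := by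
  have hinj : Function.Injective (Matrix.toLin' M) := by
    refine (injective_iff_map_eq_zero _).2 fun v hv => ?_
    rw [Matrix.toLin'_apply] at hv
    exact Matrix.eq_zero_of_mulVec_eq_zero hM hv
  have h := Submodule.natAbs_det_equiv _ (LinearEquiv.ofInjective _ hinj)
  rw [← LinearMap.det_toLin' M]
  exact h.symm

/-- The sublattice of `ℤ³` spanned by `(A, c, b)`, `(0, B, a)` and `(0, 0, C)`. -/
def hnf (A B C a b c : ℤ) : AddSubgroup (Fin 3 → ℤ) :=
  (LinearMap.range (Matrix.toLin' !![A, 0, 0; c, B, 0; b, a, C])).toAddSubgroup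

section hnf

variable {A B C a b c : ℤ}

theorem mem_hnf {v : Fin 3 → ℤ} : v ∈ hnf A B C a b c ↔
    ∃ x y z, v 0 = x * A ∧ v 1 = x * c + y * B ∧ v 2 = x * b + y * a + z * C := by
  constructor
  · rintro ⟨w, rfl⟩
    refine ⟨w 0, w 1, w 2, ?_, ?_, ?_⟩ <;>
      simp [Matrix.mulVec, dotProduct, Fin.sum_univ_three] <;> ring
  · rintro ⟨x, y, z, h0, h1, h2⟩
    refine ⟨![x, y, z], ?_⟩
    ext i
    fin_cases i <;>
      simp [Matrix.mulVec, dotProduct, Fin.sum_univ_three, h0, h1, h2] <;> ring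

theorem index_hnf (h : A * B * C ≠ 0) : (hnf A B C a b c).index = (A * B * C).natAbs := by
  have hdet : Matrix.det !![A, 0, 0; c, B, 0; b, a, C] = A * B * C := by
    simp [Matrix.det_fin_three]
  rw [hnf, AddSubgroup.index_range_toLin' _ (by rwa [hdet]), hdet]

theorem fst_mem_hnf : ![A, c, b] ∈ hnf A B C a b c := mem_hnf.2 ⟨1, 0, 0, by simp⟩

theorem snd_mem_hnf : ![0, B, a] ∈ hnf A B C a b c := mem_hnf.2 ⟨0, 1, 0, by simp⟩

theorem trd_mem_hnf : ![0, 0, C] ∈ hnf A B C a b c := mem_hnf.2 ⟨0, 0, 1, by simp⟩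

theorem hnf_le {L : AddSubgroup (Fin 3 → ℤ)} (h1 : ![A, c, b] ∈ L) (h2 : ![0, B, a] ∈ L)
    (h3 : ![0, 0, C] ∈ L) : hnf A B C a b c ≤ L := by
  intro v hv
  obtain ⟨x, y, z, e0, e1, e2⟩ := mem_hnf.1 hv
  have : v = x • ![A, c, b] + y • ![0, B, a] + z • ![0, 0, C] := by
    ext i
    fin_cases i <;> simp [e0, e1, e2]
  rw [this]
  exact add_mem (add_mem (zsmul_mem h1 _) (zsmul_mem h2 _)) (zsmul_mem h3 _)

theorem hnf_tailMul_mem_iff (hA : A ≠ 0) (hB : B ≠ 0) :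
    (∀ u ∈ hnf A B C a b c, ∀ v ∈ hnf A B C a b c, Rt4.tailMul u v ∈ hnf A B C a b c) ↔
      B ∣ A ^ 2 ∧ C ∣ A * B ∧ B * C ∣ A * (2 * B * c - A * a) := by
  constructor
  · intro h
    obtain ⟨x, y, z, e0, e1, e2⟩ := mem_hnf.1 (h _ fst_mem_hnf _ fst_mem_hnf)
    obtain ⟨x', y', z', e0', e1', e2'⟩ := mem_hnf.1 (h _ fst_mem_hnf _ snd_mem_hnf)
    simp [Rt4.tailMul, hA] at e0 e1 e2 e0' e1' e2'
    subst e0 e0'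
    have hy' : y' = 0 := by simpa [hB] using e1'
    subst hy'
    refine ⟨⟨y, by linear_combination e1⟩, ⟨z', by linear_combination e2'⟩,
      ⟨z, by linear_combination B * e2 - a * e1⟩⟩
  · rintro ⟨⟨y₁, h₁⟩, ⟨z₂, h₂⟩, ⟨z₁, h₃⟩⟩ u hu v hv
    obtain ⟨x, y, z, e0, e1, e2⟩ := mem_hnf.1 hu
    obtain ⟨x', y', z', e0', e1', e2'⟩ := mem_hnf.1 hv
    have h₄ : 2 * A * c - y₁ * a = C * z₁ := by
      apply mul_left_cancel₀ hB
      linear_combination h₃ + a * h₁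
    refine mem_hnf.2 ⟨0, x * x' * y₁, x * x' * z₁ + (x * y' + x' * y) * z₂, ?_, ?_, ?_⟩ <;>
      simp [Rt4.tailMul, e0, e1, e0', e1']
    · linear_combination x * x' * h₁
    · linear_combination x * x' * h₄ + (x * y' + x' * y) * h₂

/-- If two elements of `L` have a `2 × 2` minor prime to an integer `q` annihilating the
quotient by `L`, that quotient is cyclic. -/
theorem isAddCyclic_quotient_of_minor {L : AddSubgroup (Fin 3 → ℤ)} {q : ℤ}
    (hq : ∀ x, q • x ∈ L) {u v : Fin 3 → ℤ} (hu : u ∈ L) (hv : v ∈ L) (i j k : Fin 3)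
    (hij : i ≠ j) (hik : i ≠ k) (hjk : j ≠ k) (hco : IsCoprime q (u i * v j - u j * v i)) :
    IsAddCyclic ((Fin 3 → ℤ) ⧸ L) := by
  rw [isAddCyclic_quotient_iff]
  obtain ⟨s, t, hst⟩ := hco
  refine ⟨Pi.single k 1, fun x => ⟨(x k - t * ((x i * v j - x j * v i) * u k +
    (x j * u i - x i * u j) * v k) - s * q * x k), ?_⟩⟩
  have hx : ∀ l, l = i ∨ l = j ∨ l = k := by omega
  have : x - (x k - t * ((x i * v j - x j * v i) * u k +
      (x j * u i - x i * u j) * v k) - s * q * x k) • Pi.single k 1 =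
      s • q • x + (t * (x i * v j - x j * v i)) • u + (t * (x j * u i - x i * u j)) • v := by
    ext l
    rcases hx l with rfl | rfl | rfl
    · simp [hik]
      linear_combination (-x l) * hst
    · simp [hjk]
      linear_combination (-x l) * hst
    · simp
      ring
  rw [this]
  exact add_mem (add_mem (zsmul_mem (hq x) _) (zsmul_mem hu _)) (zsmul_mem hv _)

theorem isAddCyclic_quotient_hnf_iff {p : ℤ} (hp : Prime p) {m : ℕ} (h : A * B * C = p ^ m) :
    IsAddCyclic ((Fin 3 → ℤ) ⧸ hnf A B C a b c) ↔
      ¬ (p ∣ A * B ∧ p ∣ A * a ∧ p ∣ a * c - B * b ∧ p ∣ A * C ∧ p ∣ C * c ∧ p ∣ B * C) := by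
  constructor
  · rw [isAddCyclic_quotient_iff]
    rintro ⟨g, hg⟩ ⟨⟨m₁, h₁⟩, ⟨m₂, h₂⟩, ⟨m₃, h₃⟩, ⟨m₄, h₄⟩, ⟨m₅, h₅⟩, ⟨m₆, h₆⟩⟩
    have key : ∀ u ∈ hnf A B C a b c, ∀ v ∈ hnf A B C a b c, ∃ d₀ d₁ d₂,
        u 0 * v 1 - u 1 * v 0 = p * d₀ ∧ u 0 * v 2 - u 2 * v 0 = p * d₁ ∧
        u 1 * v 2 - u 2 * v 1 = p * d₂ := by
      intro u hu v hv
      obtain ⟨x, y, z, e0, e1, e2⟩ := mem_hnf.1 hu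
      obtain ⟨x', y', z', e0', e1', e2'⟩ := mem_hnf.1 hv
      rw [e0, e1, e2, e0', e1', e2']
      refine ⟨(x * y' - y * x') * m₁, (x * y' - y * x') * m₂ + (x * z' - z * x') * m₄,
        (x * y' - y * x') * m₃ + (x * z' - z * x') * m₅ + (y * z' - z * y') * m₆, ?_, ?_, ?_⟩
      · linear_combination (x * y' - y * x') * h₁
      · linear_combination (x * y' - y * x') * h₂ + (x * z' - z * x') * h₄
      · linear_combination (x * y' - y * x') * h₃ + (x * z' - z * x') * h₅ +
          (y * z' - z * y') * h₆
    obtain ⟨n₀, hn₀⟩ := hg ![1, 0, 0]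
    obtain ⟨n₁, hn₁⟩ := hg ![0, 1, 0]
    obtain ⟨n₂, hn₂⟩ := hg ![0, 0, 1]
    obtain ⟨a₀, a₁, a₂, ha₀, ha₁, ha₂⟩ := key _ hn₀ _ hn₁
    obtain ⟨b₀, b₁, b₂, hb₀, hb₁, hb₂⟩ := key _ hn₀ _ hn₂
    obtain ⟨c₀, c₁, c₂, hc₀, hc₁, hc₂⟩ := key _ hn₁ _ hn₂
    simp at ha₀ ha₁ ha₂ hb₀ hb₁ hb₂ hc₀ hc₁ hc₂
    apply hp.not_isUnit
    rw [isUnit_iff_dvd_one]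
    refine ⟨c₂ - n₁ * (g 0 * b₂ - g 1 * b₁ + g 2 * b₀) +
      n₂ * (g 0 * a₂ - g 1 * a₁ + g 2 * a₀), ?_⟩
    linear_combination hc₂ - n₁ * (g 0 * hb₂ - g 1 * hb₁ + g 2 * hb₀) +
      n₂ * (g 0 * ha₂ - g 1 * ha₁ + g 2 * ha₀)
  · intro hnot
    have hq : ∀ x, (p ^ m : ℤ) • x ∈ hnf A B C a b c := by
      intro x
      refine mem_hnf.2 ⟨x 0 * (B * C), (x 1 * A - x 0 * c) * C,
        x 2 * A * B - x 0 * b * B - (x 1 * A - x 0 * c) * a, ?_, ?_, ?_⟩ <;>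
        simp [← h] <;> ring
    have hco : ∀ d, ¬ p ∣ d → IsCoprime (p ^ m) d := fun d hd =>
      ((hp.coprime_iff_not_dvd).2 hd).pow_left
    by_contra hcyc
    have key : ∀ u ∈ hnf A B C a b c, ∀ v ∈ hnf A B C a b c, ∀ i j k : Fin 3,
        i ≠ j → i ≠ k → j ≠ k → p ∣ u i * v j - u j * v i := by
      intro u hu v hv i j k hij hik hjk
      by_contra hd
      exact hcyc (isAddCyclic_quotient_of_minor hq hu hv i j k hij hik hjk (hco _ hd))
    apply hnot
    refine ⟨?_, ?_, ?_, ?_, ?_, ?_⟩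
    · simpa using key _ fst_mem_hnf _ snd_mem_hnf 0 1 2
    · simpa using key _ fst_mem_hnf _ snd_mem_hnf 0 2 1
    · simpa [mul_comm] using key _ fst_mem_hnf _ snd_mem_hnf 1 2 0
    · simpa using key _ fst_mem_hnf _ trd_mem_hnf 0 2 1
    · simpa [mul_comm] using key _ fst_mem_hnf _ trd_mem_hnf 1 2 0
    · simpa using key _ snd_mem_hnf _ trd_mem_hnf 1 2 0

theorem dvd_of_hnf_le {A' B' C' a' b' c' : ℤ} (hA : A' ≠ 0) (hB : B' ≠ 0)
    (h : hnf A B C a b c ≤ hnf A' B' C' a' b' c') : A' ∣ A ∧ B' ∣ B ∧ C' ∣ C := by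
  obtain ⟨x₁, y₁, z₁, d₁, e₁, f₁⟩ := mem_hnf.1 (h fst_mem_hnf)
  obtain ⟨x₂, y₂, z₂, d₂, e₂, f₂⟩ := mem_hnf.1 (h snd_mem_hnf)
  obtain ⟨x₃, y₃, z₃, d₃, e₃, f₃⟩ := mem_hnf.1 (h trd_mem_hnf)
  simp [hA] at d₁ e₁ f₁ d₂ e₂ f₂ d₃ e₃ f₃
  subst d₂ d₃
  have hy : y₃ = 0 := by simpa [hB] using e₃
  subst hy
  exact ⟨⟨x₁, by linarith⟩, ⟨y₂, by linarith⟩, ⟨z₃, by linarith⟩⟩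

theorem eq_of_hnf_le_of_reduced {a' b' c' : ℤ} (hA : 0 < A) (hB : 0 < B)
    (ha : 0 ≤ a ∧ a < C) (hb : 0 ≤ b ∧ b < C) (hc : 0 ≤ c ∧ c < B)
    (ha' : 0 ≤ a' ∧ a' < C) (hb' : 0 ≤ b' ∧ b' < C) (hc' : 0 ≤ c' ∧ c' < B)
    (h : hnf A B C a b c ≤ hnf A B C a' b' c') : a = a' ∧ b = b' ∧ c = c' := by
  have red : ∀ {N s t z : ℤ}, 0 ≤ s ∧ s < N → 0 ≤ t ∧ t < N → s = t + z * N → s = t := by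
    intro N s t z hs ht he
    rw [← Int.emod_eq_of_lt hs.1 hs.2, he, Int.add_mul_emod_self_right,
      Int.emod_eq_of_lt ht.1 ht.2]
  obtain ⟨x₁, y₁, z₁, d₁, e₁, f₁⟩ := mem_hnf.1 (h fst_mem_hnf)
  obtain ⟨x₂, y₂, z₂, d₂, e₂, f₂⟩ := mem_hnf.1 (h snd_mem_hnf)
  simp [hA.ne'] at d₁ e₁ f₁ d₂ e₂ f₂
  subst d₁ d₂
  have hcc : c = c' := red (z := y₁) hc hc' (by linarith)
  have hy₁ : y₁ = 0 := by simpa [hcc, hB.ne'] using e₁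
  have hy₂ : y₂ = 1 := by simpa [hB.ne'] using e₂
  subst hy₁ hy₂
  exact ⟨red (z := z₂) ha ha' (by linarith), red (z := z₁) hb hb' (by linarith), hcc⟩

end hnf

theorem Int.exists_zmultiples_prime_pow {p m : ℕ} (hp : p.Prime) (H : AddSubgroup ℤ)
    (h : (p : ℤ) ^ m ∈ H) : ∃ r : ℕ, H = AddSubgroup.zmultiples ((p : ℤ) ^ r) := by
  obtain ⟨g, rfl⟩ := Int.subgroup_cyclic H
  rw [← AddSubgroup.zmultiples_eq_closure] at h ⊢
  have hg : g.natAbs ∣ p ^ m := by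
    simpa [Int.natAbs_pow] using Int.natAbs_dvd_natAbs.2 (Int.mem_zmultiples_iff.1 h)
  obtain ⟨r, -, hr⟩ := (Nat.dvd_prime_pow hp).1 hg
  exact ⟨r, by rw [← Int.zmultiples_natAbs, hr, Nat.cast_pow]⟩

theorem exists_eq_hnf {p m : ℕ} (hp : p.Prime) (L : AddSubgroup (Fin 3 → ℤ))
    (hL : L.index = p ^ m) : ∃ (k l r : ℕ) (a b c : ℤ), (0 ≤ a ∧ a < (p : ℤ) ^ k) ∧
      (0 ≤ b ∧ b < (p : ℤ) ^ k) ∧ (0 ≤ c ∧ c < (p : ℤ) ^ l) ∧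
      L = hnf (p ^ r) (p ^ l) (p ^ k) a b c := by
  have hmem : ∀ v, ((p : ℤ) ^ m) • v ∈ L := by
    intro v
    have := L.nsmul_index_mem v
    rw [hL, ← natCast_zsmul] at this
    exact_mod_cast this
  obtain ⟨r, hr⟩ := Int.exists_zmultiples_prime_pow (m := m) hp
    (L.map (Pi.evalAddMonoidHom (fun _ : Fin 3 => ℤ) 0)) ⟨_, hmem ![1, 0, 0], by simp⟩
  obtain ⟨l, hl⟩ := Int.exists_zmultiples_prime_pow (m := m) hp
    ((L ⊓ (Pi.evalAddMonoidHom (fun _ : Fin 3 => ℤ) 0).ker).map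
      (Pi.evalAddMonoidHom (fun _ : Fin 3 => ℤ) 1)) ⟨_, ⟨hmem ![0, 1, 0], by simp⟩, by simp⟩
  obtain ⟨k, hk⟩ := Int.exists_zmultiples_prime_pow (m := m) hp
    ((L ⊓ (Pi.evalAddMonoidHom (fun _ : Fin 3 => ℤ) 0).ker ⊓
      (Pi.evalAddMonoidHom (fun _ : Fin 3 => ℤ) 1).ker).map
      (Pi.evalAddMonoidHom (fun _ : Fin 3 => ℤ) 2))
      ⟨_, ⟨⟨hmem ![0, 0, 1], by simp⟩, by simp⟩, by simp⟩
  have hpos : ∀ n : ℕ, 0 < (p : ℤ) ^ n := fun n => pow_pos (by exact_mod_cast hp.pos) n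
  obtain ⟨v₁, h₁, h₁0⟩ := hr ▸ AddSubgroup.mem_zmultiples ((p : ℤ) ^ r)
  obtain ⟨v₂, ⟨h₂, h₂0⟩, h₂1⟩ := hl ▸ AddSubgroup.mem_zmultiples ((p : ℤ) ^ l)
  obtain ⟨v₃, ⟨⟨h₃, h₃0⟩, h₃1⟩, h₃2⟩ := hk ▸ AddSubgroup.mem_zmultiples ((p : ℤ) ^ k)
  simp at h₁0 h₂0 h₂1 h₃0 h₃1 h₃2
  have m₃ : ![0, 0, (p : ℤ) ^ k] ∈ L := by
    convert (show v₃ ∈ L from h₃) using 1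
    ext i
    fin_cases i <;> simp [h₃0, h₃1, h₃2]
  have m₂ : ![0, (p : ℤ) ^ l, v₂ 2 % (p : ℤ) ^ k] ∈ L := by
    convert sub_mem (show v₂ ∈ L from h₂) (zsmul_mem m₃ (v₂ 2 / (p : ℤ) ^ k)) using 1
    ext i
    fin_cases i <;> simp [h₂0, h₂1, Int.emod_def, mul_comm]
  set a := v₂ 2 % (p : ℤ) ^ k with ha
  set b := v₁ 2 - v₁ 1 / (p : ℤ) ^ l * a with hb
  have m₁ : ![(p : ℤ) ^ r, v₁ 1 % (p : ℤ) ^ l, b % (p : ℤ) ^ k] ∈ L := by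
    convert sub_mem (sub_mem h₁ (zsmul_mem m₂ (v₁ 1 / (p : ℤ) ^ l)))
      (zsmul_mem m₃ (b / (p : ℤ) ^ k)) using 1
    ext i
    fin_cases i <;> simp [Matrix.vecHead, Matrix.vecTail, h₁0, hb, Int.emod_def, mul_comm]
  refine ⟨k, l, r, a, b % (p : ℤ) ^ k, v₁ 1 % (p : ℤ) ^ l,
    ⟨Int.emod_nonneg _ (hpos k).ne', Int.emod_lt_of_pos _ (hpos k)⟩,
    ⟨Int.emod_nonneg _ (hpos k).ne', Int.emod_lt_of_pos _ (hpos k)⟩,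
    ⟨Int.emod_nonneg _ (hpos l).ne', Int.emod_lt_of_pos _ (hpos l)⟩,
    le_antisymm (fun v hv => ?_) (hnf_le m₁ m₂ m₃)⟩
  obtain ⟨x, hx⟩ := Int.mem_zmultiples_iff.1 (hr ▸ AddSubgroup.mem_map_of_mem _ hv)
  have hv' := sub_mem hv (zsmul_mem m₁ x)
  obtain ⟨y, hy⟩ := Int.mem_zmultiples_iff.1 (hl ▸ AddSubgroup.mem_map_of_mem _
    (AddSubgroup.mem_inf.2 ⟨hv', by
      simpa [Matrix.vecHead, Matrix.vecTail, mul_comm, sub_eq_zero] using hx⟩))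
  have hv'' := sub_mem hv' (zsmul_mem m₂ y)
  obtain ⟨z, hz⟩ := Int.mem_zmultiples_iff.1 (hk ▸ AddSubgroup.mem_map_of_mem _
    (AddSubgroup.mem_inf.2 ⟨AddSubgroup.mem_inf.2 ⟨hv'',
      by simpa [Matrix.vecHead, Matrix.vecTail, mul_comm, sub_eq_zero] using hx⟩,
      by simpa [Matrix.vecHead, Matrix.vecTail, mul_comm, sub_eq_zero] using hy⟩))
  simp [Matrix.vecHead, Matrix.vecTail] at hx hy hz
  exact mem_hnf.2 ⟨x, y, z, by linarith, by linarith, by linarith⟩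

theorem pow_dvd_pow_mul_iff {p : ℤ} (hp : p ≠ 0) (n r : ℕ) (x : ℤ) :
    p ^ n ∣ p ^ r * x ↔ (r < n → p ^ (n - r) ∣ x) := by
  rcases lt_or_ge r n with h | h
  · obtain ⟨d, rfl⟩ := Nat.exists_eq_add_of_le h.le
    rw [pow_add, mul_dvd_mul_iff_left (pow_ne_zero _ hp), Nat.add_sub_cancel_left]
    exact ⟨fun h _ => h, fun h' => h' h⟩
  · exact ⟨fun _ h' => absurd h' h.not_gt, fun _ => (pow_dvd_pow p h).mul_right x⟩

theorem Prime.gcd_pow_eq_one_iff {p : ℤ} (hp : Prime p) (n : ℕ) (x : ℤ) :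
    gcd (p ^ n) x = 1 ↔ ¬ (p ∣ p ^ n ∧ p ∣ x) := by
  rw [← dvd_gcd_iff]
  constructor
  · intro h hd
    exact hp.not_isUnit (isUnit_of_dvd_one (h ▸ hd))
  · intro h
    have hu : IsUnit (gcd (p ^ n) x) :=
      ((hp.coprime_iff_not_dvd.2 h).pow_left (m := n)).isUnit_of_dvd' (gcd_dvd_left _ _) dvd_rfl
    rw [← normalize_gcd, normalize_eq_one]
    exact hu

/-- `a_R^{cc}(pᵐ)` equals the number of tuples `(k, l, r, a₂₁, a₃₁, a₃₂)` with
`k + l + r = m`, `0 ≤ a₂₁, a₃₁ < pᵏ`, `0 ≤ a₃₂ < pˡ`, `l ≤ 2r`, `k ≤ l + r`,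
`p^{k+l−r} ∣ 2pˡa₃₂ − pʳa₂₁` whenever `k + l − r > 0`, and
`gcd(p^{k+l+r}, p^{l+r}, pʳa₂₁, a₂₁a₃₂ − pˡa₃₁, p^{k+r}, pᵏa₃₂, p^{k+l}) = 1`. -/
theorem stmt_15 (p : ℕ) (hp : p.Prime) (m : ℕ) :
    aRcc (p ^ m) =
      Nat.card {t : ℕ × ℕ × ℕ × ℤ × ℤ × ℤ //
        t.1 + t.2.1 + t.2.2.1 = m ∧
        0 ≤ t.2.2.2.1 ∧ t.2.2.2.1 < (p : ℤ) ^ t.1 ∧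
        0 ≤ t.2.2.2.2.1 ∧ t.2.2.2.2.1 < (p : ℤ) ^ t.1 ∧
        0 ≤ t.2.2.2.2.2 ∧ t.2.2.2.2.2 < (p : ℤ) ^ t.2.1 ∧
        t.2.1 ≤ 2 * t.2.2.1 ∧ t.1 ≤ t.2.1 + t.2.2.1 ∧
        (t.2.2.1 < t.1 + t.2.1 →
          (p : ℤ) ^ (t.1 + t.2.1 - t.2.2.1) ∣
            2 * (p : ℤ) ^ t.2.1 * t.2.2.2.2.2 - (p : ℤ) ^ t.2.2.1 * t.2.2.2.1) ∧
        gcd ((p : ℤ) ^ (t.1 + t.2.1 + t.2.2.1))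
          (gcd ((p : ℤ) ^ (t.2.1 + t.2.2.1))
            (gcd ((p : ℤ) ^ t.2.2.1 * t.2.2.2.1)
              (gcd (t.2.2.2.1 * t.2.2.2.2.2 - (p : ℤ) ^ t.2.1 * t.2.2.2.2.1)
                (gcd ((p : ℤ) ^ (t.1 + t.2.2.1))
                  (gcd ((p : ℤ) ^ t.1 * t.2.2.2.2.2)
                    ((p : ℤ) ^ (t.1 + t.2.1))))))) = 1} := by
  have hpos : ∀ n : ℕ, 0 < (p : ℤ) ^ n := fun n => pow_pos (by exact_mod_cast hp.pos) n
  have hpp : Prime (p : ℤ) := Nat.prime_iff_prime_int.1 hp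
  have hcast : ∀ {i j : ℕ}, (p : ℤ) ^ i ∣ (p : ℤ) ^ j ↔ i ≤ j := fun {i j} =>
    pow_dvd_pow_iff hpp.ne_zero hpp.not_isUnit
  have hindex : ∀ (k l r : ℕ) (a b c : ℤ),
      (hnf (p ^ r) (p ^ l) (p ^ k) a b c).index = p ^ (k + l + r) := by
    intro k l r a b c
    rw [index_hnf (mul_pos (mul_pos (hpos r) (hpos l)) (hpos k)).ne', ← pow_add, ← pow_add,
      Int.natAbs_pow, Int.natAbs_natCast]
    congr 1
    ring
  have hcond : ∀ (k l r : ℕ) (a b c : ℤ), k + l + r = m →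
      (((∀ u ∈ hnf (p ^ r) (p ^ l) (p ^ k) a b c, ∀ v ∈ hnf (p ^ r) (p ^ l) (p ^ k) a b c,
          Rt4.tailMul u v ∈ hnf (p ^ r) (p ^ l) (p ^ k) a b c) ∧
        IsAddCyclic ((Fin 3 → ℤ) ⧸ hnf (p ^ r) (p ^ l) (p ^ k) a b c)) ↔
      l ≤ 2 * r ∧ k ≤ l + r ∧
        (r < k + l → (p : ℤ) ^ (k + l - r) ∣ 2 * (p : ℤ) ^ l * c - (p : ℤ) ^ r * a) ∧
        gcd ((p : ℤ) ^ (k + l + r)) (gcd ((p : ℤ) ^ (l + r)) (gcd ((p : ℤ) ^ r * a)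
          (gcd (a * c - (p : ℤ) ^ l * b) (gcd ((p : ℤ) ^ (k + r))
            (gcd ((p : ℤ) ^ k * c) ((p : ℤ) ^ (k + l))))))) = 1) := by
    intro k l r a b c hm
    rw [hnf_tailMul_mem_iff (hpos r).ne' (hpos l).ne',
      isAddCyclic_quotient_hnf_iff hpp (m := m) (by rw [← hm]; ring), hpp.gcd_pow_eq_one_iff,
      ← pow_dvd_pow_mul_iff hpp.ne_zero, ← pow_mul, ← pow_add, ← pow_add, hcast, hcast,
      add_comm r l, mul_comm r 2, add_comm l k, and_assoc, and_assoc]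
    simp only [dvd_gcd_iff]
    have h1 : (p : ℤ) ∣ p ^ (l + r) → (p : ℤ) ∣ p ^ (k + l + r) := fun h =>
      h.trans (pow_dvd_pow _ (by omega))
    rw [← pow_add _ r k, add_comm r k]
    tauto
  rw [aRcc_eq_card_lattices]
  symm
  refine Nat.card_eq_of_bijective (fun t => ⟨hnf (p ^ t.1.2.2.1) (p ^ t.1.2.1) (p ^ t.1.1)
    t.1.2.2.2.1 t.1.2.2.2.2.1 t.1.2.2.2.2.2, ?_⟩) ⟨?_, ?_⟩
  · obtain ⟨⟨k, l, r, a, b, c⟩, hm, ha, ha', hb, hb', hc, hc', h⟩ := t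
    have := (hcond k l r a b c hm).2 h
    exact ⟨this.1, by rw [hindex]; exact congrArg _ hm, this.2⟩
  · rintro ⟨⟨k, l, r, a, b, c⟩, hm, ha, ha', hb, hb', hc, hc', h⟩
      ⟨⟨k₁, l₁, r₁, a₁, b₁, c₁⟩, hm₁, ha₁, ha₁', hb₁, hb₁', hc₁, hc₁', h₁⟩ heq
    dsimp only at *
    have heq := congrArg Subtype.val heq
    dsimp only at heq
    obtain ⟨hr, hl, hk⟩ := dvd_of_hnf_le (hpos _).ne' (hpos _).ne' heq.le
    obtain ⟨hr', hl', hk'⟩ := dvd_of_hnf_le (hpos _).ne' (hpos _).ne' heq.ge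
    rw [hcast] at hr hl hk hr' hl' hk'
    obtain rfl := le_antisymm hr hr'
    obtain rfl := le_antisymm hl hl'
    obtain rfl := le_antisymm hk hk'
    obtain ⟨rfl, rfl, rfl⟩ := eq_of_hnf_le_of_reduced (hpos _) (hpos _) ⟨ha, ha'⟩ ⟨hb, hb'⟩
      ⟨hc, hc'⟩ ⟨ha₁, ha₁'⟩ ⟨hb₁, hb₁'⟩ ⟨hc₁, hc₁'⟩ heq.le
    rfl
  · rintro ⟨L, hmul, hidx, hcyc⟩
    obtain ⟨k, l, r, a, b, c, ha, hb, hc, rfl⟩ := exists_eq_hnf hp L hidx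
    rw [hindex] at hidx
    have hm := Nat.pow_right_injective hp.two_le hidx
    exact ⟨⟨(k, l, r, a, b, c), hm, ha.1, ha.2, hb.1, hb.2, hc.1, hc.2,
      (hcond k l r a b c hm).1 ⟨hmul, hcyc⟩⟩, rfl⟩
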